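/- Let A=(Q,Σ,δ,ρ) be a connected bireversible Mealy automaton whose orbit tree o(A) has no active self-liftable branch, and let j be a jungle tree of o(A) with trunk of length n. For every ∼-class γ of stems and every j-word u with |u|<n that is a prefix of some stem of γ, the number of states q∈Q such that u·q is a prefix of some stem of γ is at least 2. -/

import Mathlib

open List

variable {Q A : Type*}

/-- Action of a state on words over the alphabet:
`ρ_x(i·s) = ρ_x(i) · ρ_{δ_i(x)}(s)`. -/
def mrho (d : A → Q → Q) (r : Q → A → A) : Q → List A → List A
  | _, [] => []
  | x, i :: s => r x i :: mrho d r (d i x) s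

/-- Action of a word of states: `ρ_{x₁⋯x_m} = ρ_{x_m} ∘ ⋯ ∘ ρ_{x₁}`. -/
def mrhoW (d : A → Q → Q) (r : Q → A → A) : List Q → List A → List A
  | [], s => s
  | x :: u, s => mrhoW d r u (mrho d r x s)

/-- Dual action of a letter on words of states:
`δ_i(x·u) = δ_i(x) · δ_{ρ_x(i)}(u)`. -/
def mdel (d : A → Q → Q) (r : Q → A → A) : A → List Q → List Q
  | _, [] => []
  | i, x :: u => d i x :: mdel d r (r x i) u

/-- Action of a word of letters: `δ_{s₁⋯s_m} = δ_{s_m} ∘ ⋯ ∘ δ_{s₁}`. -/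
def mdelW (d : A → Q → Q) (r : Q → A → A) : List A → List Q → List Q
  | [], u => u
  | i :: s, u => mdelW d r s (mdel d r i u)

/-- Connected component (orbit under the dual action) of a word of states. -/
def mOrbit (d : A → Q → Q) (r : Q → A → A) (u : List Q) : Set (List Q) :=
  { v | ∃ s : List A, mdelW d r s u = v }

/-- The Mealy automaton is invertible. -/
def MInvertible (r : Q → A → A) : Prop := ∀ x : Q, Function.Bijective (r x)

/-- The Mealy automaton is reversible. -/
def MReversible (d : A → Q → Q) : Prop := ∀ i : A, Function.Bijective (d i)

/-- The Mealy automaton is connected. -/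
def MConnected (d : A → Q → Q) (r : Q → A → A) : Prop :=
  ∀ x y : Q, ∃ s : List A, mdelW d r s [x] = [y]

/-- The Mealy automaton is bireversible: invertible, reversible, and for each output
letter `j`, the map sending `x` to `δ_i(x)` (where `i` is the unique letter with
`ρ_x(i) = j`) is a permutation of the (finite) stateset, encoded as injectivity. -/
def MBireversible (d : A → Q → Q) (r : Q → A → A) : Prop :=
  MInvertible r ∧ MReversible d ∧
    ∀ (x y : Q) (i i' : A), r x i = r y i' → d i x = d i' y → x = y

/-- The edge of the orbit tree whose bottom is the component of `e` is liftable
to the edge whose bottom is the component of `f`: every word of `⊥(e)` admits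
some word of `⊥(f)` as a suffix. -/
def EdgeLiftable (d : A → Q → Q) (r : Q → A → A) (e f : List Q) : Prop :=
  ∀ v ∈ mOrbit d r e, ∃ v' ∈ mOrbit d r f, v' <:+ v

/-- Prefix of length `m` of the infinite word `α : ℕ → Q`. -/
def branchPrefix (α : ℕ → Q) (m : ℕ) : List Q := (List.range m).map α

/-- The orbit tree admits an active self-liftable branch: a branch, represented by
an infinite word `α`, which is `k`-self-liftable for some `k ≥ 1` (every edge at
level `j + k` of the branch is liftable to the edge at level `j`), and active
(its label sequence is not eventually `1`, i.e. the sizes of the components of the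
prefixes do not become eventually constant). -/
def HasActiveSelfLiftableBranch (d : A → Q → Q) (r : Q → A → A) : Prop :=
  ∃ (α : ℕ → Q) (k : ℕ), 1 ≤ k ∧
    (∀ j : ℕ, 1 ≤ j → EdgeLiftable d r (branchPrefix α (j + k)) (branchPrefix α j)) ∧
    ∀ N : ℕ, ∃ m : ℕ, N ≤ m ∧
      (mOrbit d r (branchPrefix α (m + 1))).ncard ≠ (mOrbit d r (branchPrefix α m)).ncard

/-- `t` represents the trunk of a jungle tree: a non-empty finite initial
`1`-self-liftable path (each edge of the trunk is liftable to the preceding one)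
such that the bottom of the trunk has at least two legitimate children
(children liftable to the last trunk edge), and every legitimate child has label `1`. -/
def IsJungleTrunk (d : A → Q → Q) (r : Q → A → A) (t : List Q) : Prop :=
  t ≠ [] ∧
  (∀ j : ℕ, 2 ≤ j → j ≤ t.length → EdgeLiftable d r (t.take j) (t.take (j - 1))) ∧
  (∃ x y : Q, mOrbit d r (t ++ [x]) ≠ mOrbit d r (t ++ [y]) ∧
    EdgeLiftable d r (t ++ [x]) t ∧ EdgeLiftable d r (t ++ [y]) t) ∧
  ∀ x : Q, EdgeLiftable d r (t ++ [x]) t →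
    (mOrbit d r (t ++ [x])).ncard = (mOrbit d r t).ncard

/-- `u` is a `j`-word for the jungle tree with trunk `t`: the sequence of connected
components of the prefixes of `u` is an initial path of the jungle tree, i.e. the
component of each prefix of length `i ≤ |t|` coincides with the component of the
corresponding trunk prefix, and each deeper edge is liftable to the last trunk edge. -/
def IsJWord (d : A → Q → Q) (r : Q → A → A) (t u : List Q) : Prop :=
  (∀ i : ℕ, i ≤ u.length → i ≤ t.length → u.take i ∈ mOrbit d r (t.take i)) ∧
  ∀ l : ℕ, t.length ≤ l → l < u.length → EdgeLiftable d r (u.take (l + 1)) t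

/-- A stem is a `j`-word whose length is the length of the trunk. -/
def IsStem (d : A → Q → Q) (r : Q → A → A) (t u : List Q) : Prop :=
  IsJWord d r t u ∧ u.length = t.length

/-- A cyclic `j`-word is a finite word all of whose powers are `j`-words. -/
def IsCyclicJWord (d : A → Q → Q) (r : Q → A → A) (t u : List Q) : Prop :=
  ∀ k : ℕ, IsJWord d r t (List.flatten (List.replicate k u))

/-- The relation `∼` on stems: `u ∼ v` whenever there is `s` such that `u·s·v` is a
`j`-word and `ρ_{u·s}` acts like the identity on `Σ*`. -/
def StemEquiv (d : A → Q → Q) (r : Q → A → A) (t u v : List Q) : Prop :=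
  ∃ s : List Q, IsJWord d r t (u ++ s ++ v) ∧ ∀ w : List A, mrhoW d r (u ++ s) w = w

section Helpers

theorem mdelW_nil (d : A → Q → Q) (r : Q → A → A) (s : List A) : mdelW d r s [] = [] := by
  induction s with
  | nil => rfl
  | cons i s ih => simpa [mdelW, mdel] using ih

theorem mdelW_cons (d : A → Q → Q) (r : Q → A → A) (s : List A) (x : Q) (u : List Q) :
    mdelW d r s (x :: u) = (s.foldl (fun x i => d i x) x) :: mdelW d r (mrho d r x s) u := by
  induction s generalizing x u with
  | nil => rfl
  | cons i s ih => simp [mdelW, mdel, mrho, ih]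

theorem mdelW_append (d : A → Q → Q) (r : Q → A → A) (s : List A) (u v : List Q) :
    mdelW d r s (u ++ v) = mdelW d r s u ++ mdelW d r (mrhoW d r u s) v := by
  induction u generalizing s with
  | nil => simp [mdelW_nil, mrhoW]
  | cons x u ih => simp [mdelW_cons, mrhoW, ih]

theorem mdelW_word_append (d : A → Q → Q) (r : Q → A → A) (s s' : List A) (u : List Q) :
    mdelW d r (s ++ s') u = mdelW d r s' (mdelW d r s u) := by
  induction s generalizing u with
  | nil => rfl
  | cons i s ih => simp [mdelW, ih]

theorem mdelW_length (d : A → Q → Q) (r : Q → A → A) (s : List A) (u : List Q) :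
    (mdelW d r s u).length = u.length := by
  induction u generalizing s with
  | nil => simp [mdelW_nil]
  | cons x u ih => simp [mdelW_cons, ih]

theorem mdelW_take (d : A → Q → Q) (r : Q → A → A) (s : List A) (u : List Q) (k : ℕ) :
    (mdelW d r s u).take k = mdelW d r s (u.take k) := by
  induction u generalizing s k with
  | nil => simp [mdelW_nil]
  | cons x u ih => cases k <;> simp [mdelW_cons, mdelW_nil, ih]

theorem mdelW_drop (d : A → Q → Q) (r : Q → A → A) (s : List A) (u : List Q) (k : ℕ) :
    (mdelW d r s u).drop k = mdelW d r (mrhoW d r (u.take k) s) (u.drop k) := by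
  induction u generalizing s k with
  | nil => simp [mdelW_nil]
  | cons x u ih => cases k <;> simp [mdelW_cons, mrhoW, ih]

theorem mrhoW_append (d : A → Q → Q) (r : Q → A → A) (u v : List Q) (s : List A) :
    mrhoW d r (u ++ v) s = mrhoW d r v (mrhoW d r u s) := by
  induction u generalizing s with
  | nil => rfl
  | cons x u ih => simp [mrhoW, ih]

theorem mrhoW_nil (d : A → Q → Q) (r : Q → A → A) (u : List Q) : mrhoW d r u [] = [] := by
  induction u with
  | nil => rfl
  | cons x u ih => simpa [mrhoW, mrho] using ih

theorem mrhoW_cons (d : A → Q → Q) (r : Q → A → A) (u : List Q) (i : A) (s : List A) :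
    mrhoW d r u (i :: s) = u.foldl (fun i x => r x i) i :: mrhoW d r (mdelW d r [i] u) s := by
  induction u generalizing i s with
  | nil => rfl
  | cons x u ih =>
    simp [mrhoW, mrho, ih, mdelW, mdel]

theorem mrho_surj (d : A → Q → Q) (r : Q → A → A) (hr : MInvertible r) (x : Q) (s : List A) :
    ∃ s', mrho d r x s' = s := by
  induction s generalizing x with
  | nil => exact ⟨[], rfl⟩
  | cons i s ih =>
    obtain ⟨j, hj⟩ := (hr x).2 i
    obtain ⟨s', hs'⟩ := ih (d j x)
    exact ⟨j :: s', by simp [mrho, hj, hs']⟩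

theorem mrhoW_surj (d : A → Q → Q) (r : Q → A → A) (hr : MInvertible r) (u : List Q)
    (s : List A) : ∃ s', mrhoW d r u s' = s := by
  induction u with
  | nil => exact ⟨s, rfl⟩
  | cons x u ih =>
    obtain ⟨s1, h1⟩ := ih
    obtain ⟨s2, h2⟩ := mrho_surj d r hr x s1
    exact ⟨s2, by simp [mrhoW, h1, h2]⟩

theorem mdel_inj (d : A → Q → Q) (r : Q → A → A) (hd : MReversible d) (i : A) :
    Function.Injective (mdel d r i) := by
  intro u
  induction u generalizing i with
  | nil => intro v h; cases v with
    | nil => rfl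
    | cons y v => simp [mdel] at h
  | cons x u ih => intro v h; cases v with
    | nil => simp [mdel] at h
    | cons y v =>
      simp only [mdel, List.cons.injEq] at h
      have hxy := (hd i).1 h.1
      subst hxy
      rw [ih _ h.2]

theorem mdelW_inj (d : A → Q → Q) (r : Q → A → A) (hd : MReversible d) (s : List A) :
    Function.Injective (mdelW d r s) := by
  induction s with
  | nil => exact fun _ _ h => h
  | cons i s ih => exact fun u v h => mdel_inj d r hd i (ih h)

theorem mOrbit_self (d : A → Q → Q) (r : Q → A → A) (u : List Q) : u ∈ mOrbit d r u := ⟨[], rfl⟩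

theorem mOrbit_trans {d : A → Q → Q} {r : Q → A → A} {u v w : List Q}
    (h1 : v ∈ mOrbit d r u) (h2 : w ∈ mOrbit d r v) : w ∈ mOrbit d r u := by
  obtain ⟨s, rfl⟩ := h1
  obtain ⟨s', rfl⟩ := h2
  exact ⟨s ++ s', mdelW_word_append ..⟩

theorem mOrbit_length {d : A → Q → Q} {r : Q → A → A} {u v : List Q}
    (h1 : v ∈ mOrbit d r u) : v.length = u.length := by
  obtain ⟨s, rfl⟩ := h1
  exact mdelW_length ..

theorem mOrbit_finite [Finite Q] (d : A → Q → Q) (r : Q → A → A) (u : List Q) :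
    (mOrbit d r u).Finite :=
  (List.finite_length_eq Q u.length).subset fun _ h => mOrbit_length h

theorem mOrbit_symm [Finite Q] {d : A → Q → Q} {r : Q → A → A} (hd : MReversible d)
    {u v : List Q} (h : v ∈ mOrbit d r u) : u ∈ mOrbit d r v := by
  obtain ⟨s, rfl⟩ := h
  have hsub : mdelW d r s '' mOrbit d r (mdelW d r s u) ⊆ mOrbit d r (mdelW d r s u) := by
    rintro _ ⟨x, hx, rfl⟩
    exact mOrbit_trans hx ⟨s, rfl⟩
  have heq := Set.eq_of_subset_of_ncard_le hsub
    (by rw [Set.ncard_image_of_injective _ (mdelW_inj d r hd s)]) (mOrbit_finite d r _)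
  have hm := mOrbit_self d r (mdelW d r s u)
  rw [← heq] at hm
  obtain ⟨x, hx, hxe⟩ := hm
  have := mdelW_inj d r hd s hxe
  rwa [this] at hx

theorem mOrbit_eq [Finite Q] {d : A → Q → Q} {r : Q → A → A} (hd : MReversible d)
    {u v : List Q} (h : v ∈ mOrbit d r u) : mOrbit d r v = mOrbit d r u :=
  Set.ext fun _ => ⟨fun hx => mOrbit_trans h hx, fun hx => mOrbit_trans (mOrbit_symm hd h) hx⟩

/-- All windows of length `|t|` are stems. -/
def JGood (d : A → Q → Q) (r : Q → A → A) (t v : List Q) : Prop :=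
  ∀ k, k + t.length ≤ v.length → (v.drop k).take t.length ∈ mOrbit d r t

theorem edgeLiftable_iff (d : A → Q → Q) (r : Q → A → A) (e f : List Q)
    (h : f.length ≤ e.length) :
    EdgeLiftable d r e f ↔ e.drop (e.length - f.length) ∈ mOrbit d r f := by
  constructor
  · intro H
    obtain ⟨v, hv, hs⟩ := H e (mOrbit_self d r e)
    rw [List.suffix_iff_eq_drop, mOrbit_length hv] at hs
    rwa [← hs]
  · rintro H v ⟨s, rfl⟩
    refine ⟨(mdelW d r s e).drop (e.length - f.length), ?_, List.drop_suffix _ _⟩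
    rw [mdelW_drop]
    exact mOrbit_trans H ⟨_, rfl⟩

theorem isJWord_iff (d : A → Q → Q) (r : Q → A → A) (t v : List Q)
    (h : t.length ≤ v.length) : IsJWord d r t v ↔ JGood d r t v := by
  have key : ∀ l, t.length ≤ l → l < v.length →
      (EdgeLiftable d r (v.take (l+1)) t ↔
        (v.drop (l + 1 - t.length)).take t.length ∈ mOrbit d r t) := by
    intro l h1 h2
    rw [edgeLiftable_iff _ _ _ _ (by simp; omega), List.drop_take]
    have e1 : (v.take (l+1)).length = l + 1 := by simp; omega
    rw [e1]
    have e2 : l + 1 - (l + 1 - t.length) = t.length := by omega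
    rw [e2]
  constructor
  · rintro ⟨H1, H2⟩ k hk
    rcases Nat.eq_zero_or_pos k with rfl | hk0
    · simpa using H1 t.length h le_rfl
    · have := (key (k + t.length - 1) (by omega) (by omega)).1
        (H2 (k + t.length - 1) (by omega) (by omega))
      have e : k + t.length - 1 + 1 - t.length = k := by omega
      rwa [e] at this
  · intro H
    constructor
    · intro i _ hi
      obtain ⟨s, hs⟩ := H 0 (by omega)
      refine ⟨s, ?_⟩
      rw [← mdelW_take, hs]
      simp [List.take_take, Nat.min_eq_left hi]
    · intro l h1 h2
      exact (key l h1 h2).2 (H _ (by omega))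

theorem isStem_iff (d : A → Q → Q) (r : Q → A → A) (t v : List Q) :
    IsStem d r t v ↔ v ∈ mOrbit d r t := by
  constructor
  · rintro ⟨h, hl⟩
    have := (isJWord_iff d r t v hl.ge).1 h 0 (by omega)
    simpa [← hl] using this
  · intro h
    have hl := mOrbit_length h
    refine ⟨(isJWord_iff d r t v hl.ge).2 ?_, hl⟩
    intro k hk
    have : k = 0 := by omega
    subst this
    simpa [← hl] using h

theorem JGood.glue {d : A → Q → Q} {r : Q → A → A} {t c v y : List Q}
    (h1 : JGood d r t (c ++ v)) (h2 : JGood d r t (v ++ y)) (hv : t.length ≤ v.length) :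
    JGood d r t (c ++ v ++ y) := by
  intro k hk
  by_cases hkc : k ≤ c.length
  · have := h1 k (by simp; omega)
    rw [List.drop_append_of_le_length (by simp; omega), List.take_append_of_le_length]
    · exact this
    · simp; omega
  · have := h2 (k - c.length) (by simp at hk ⊢; omega)
    rw [List.append_assoc, List.drop_append, List.drop_eq_nil_of_le (by omega)]
    simpa using this

theorem JGood.left {d : A → Q → Q} {r : Q → A → A} {t c v : List Q}
    (h1 : JGood d r t (c ++ v)) : JGood d r t c := by
  intro k hk
  have := h1 k (by simp; omega)
  rw [List.drop_append_of_le_length (by omega), List.take_append_of_le_length] at this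
  · exact this
  · simp; omega

theorem JGood.right {d : A → Q → Q} {r : Q → A → A} {t c v : List Q}
    (h1 : JGood d r t (c ++ v)) : JGood d r t v := by
  intro k hk
  have := h1 (c.length + k) (by simp; omega)
  rw [← List.drop_drop] at this
  simpa using this

theorem JGood.mem {d : A → Q → Q} {r : Q → A → A} {t v : List Q}
    (h1 : JGood d r t v) (hv : v.length = t.length) : v ∈ mOrbit d r t := by
  have := h1 0 (by omega)
  simpa [← hv] using this

theorem JGood.of_mem {d : A → Q → Q} {r : Q → A → A} {t v : List Q}
    (h : v ∈ mOrbit d r t) : JGood d r t v :=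
  (isJWord_iff d r t v (mOrbit_length h).ge).1 ((isStem_iff d r t v).2 h).1

theorem JGood.act {d : A → Q → Q} {r : Q → A → A} {t v : List Q}
    (h1 : JGood d r t v) (s : List A) : JGood d r t (mdelW d r s v) := by
  intro k hk
  rw [mdelW_length] at hk
  rw [mdelW_drop, mdelW_take]
  exact mOrbit_trans (h1 k hk) ⟨_, rfl⟩

theorem edge_good {d : A → Q → Q} {r : Q → A → A} {t : List Q} {x : Q} :
    EdgeLiftable d r (t ++ [x]) t ↔ JGood d r t (t ++ [x]) := by
  rw [edgeLiftable_iff _ _ _ _ (by simp)]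
  constructor
  · intro h k hk
    have : k = 0 ∨ k = 1 := by simp at hk; omega
    rcases this with rfl | rfl
    · simpa using mOrbit_self d r t
    · rw [List.take_of_length_le (by simp)]
      simpa using h
  · intro h
    have := h 1 (by simp; omega)
    rw [List.take_of_length_le (by simp)] at this
    simpa using this

variable [Finite Q] {d : A → Q → Q} {r : Q → A → A} {t : List Q}

theorem stem_ext (hd : MReversible d) (ht : IsJungleTrunk d r t) {v : List Q}
    (hv : v ∈ mOrbit d r t) : ∃ x y, x ≠ y ∧ JGood d r t (v ++ [x]) ∧ JGood d r t (v ++ [y]) := by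
  obtain ⟨x, y, hne, hx, hy⟩ := ht.2.2.1
  rw [edge_good] at hx hy
  obtain ⟨s, rfl⟩ := hv
  have hx' := hx.act s
  have hy' := hy.act s
  rw [mdelW_append, mdelW_cons, mdelW_nil] at hx' hy'
  refine ⟨_, _, ?_, hx', hy'⟩
  intro h
  apply hne
  have : mdelW d r s (t ++ [x]) = mdelW d r s (t ++ [y]) := by
    rw [mdelW_append, mdelW_append, mdelW_cons, mdelW_cons, mdelW_nil, mdelW_nil, h]
  rw [mdelW_inj d r hd s this]

theorem edge_card (hd : MReversible d) (ht : IsJungleTrunk d r t) {v : List Q} {x : Q}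
    (hv : v ∈ mOrbit d r t) (h : JGood d r t (v ++ [x])) :
    (mOrbit d r (v ++ [x])).ncard = (mOrbit d r t).ncard := by
  obtain ⟨s, hs⟩ := mOrbit_symm hd hv
  have h' := h.act s
  have he : mdelW d r s (v ++ [x]) ∈ mOrbit d r (v ++ [x]) := ⟨s, rfl⟩
  rw [← mOrbit_eq hd he]
  rw [mdelW_append, mdelW_cons, mdelW_nil, hs] at h' ⊢
  exact ht.2.2.2 _ (edge_good.2 h')

theorem edge_take_inj (hd : MReversible d) (ht : IsJungleTrunk d r t) {v : List Q} {x : Q}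
    (hv : v ∈ mOrbit d r t) (h : JGood d r t (v ++ [x])) :
    Set.InjOn (List.take t.length) (mOrbit d r (v ++ [x])) := by
  apply Set.injOn_of_ncard_image_eq _ (mOrbit_finite d r _)
  rw [edge_card hd ht hv h]
  congr 1
  have hl := mOrbit_length hv
  ext w
  constructor
  · rintro ⟨_, ⟨s, rfl⟩, rfl⟩
    rw [mdelW_take, ← hl]
    simpa using mOrbit_trans hv ⟨s, rfl⟩
  · intro hw
    rw [← mOrbit_eq hd hv] at hw
    obtain ⟨s, rfl⟩ := hw
    exact ⟨_, ⟨s, rfl⟩, by rw [mdelW_take, ← hl]; simp⟩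

theorem edge_tail_inj (hr : MInvertible r) (hd : MReversible d) (ht : IsJungleTrunk d r t)
    {v w : List Q} {x q : Q} (hv : v ∈ mOrbit d r t) (h : JGood d r t (v ++ [x]))
    (hq : v ++ [x] = q :: w) (hw : w ∈ mOrbit d r t) :
    Set.InjOn List.tail (mOrbit d r (v ++ [x])) := by
  apply Set.injOn_of_ncard_image_eq _ (mOrbit_finite d r _)
  rw [edge_card hd ht hv h]
  congr 1
  rw [hq]
  ext y
  constructor
  · rintro ⟨_, ⟨s, rfl⟩, rfl⟩
    rw [mdelW_cons]
    exact mOrbit_trans hw ⟨_, rfl⟩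
  · intro hy
    rw [← mOrbit_eq hd hw] at hy
    obtain ⟨s, rfl⟩ := hy
    obtain ⟨s', rfl⟩ := mrho_surj d r hr q s
    exact ⟨_, ⟨s', rfl⟩, by rw [mdelW_cons]; rfl⟩

/-- An element acts on a `j`-word through its action on the first stem. -/
theorem unique_ext (hd : MReversible d) (ht : IsJungleTrunk d r t) {w : List Q}
    (hw : w.length = t.length) (y : List Q) (h : JGood d r t (w ++ y)) (s s' : List A)
    (hs : mdelW d r s w = mdelW d r s' w) : mdelW d r s (w ++ y) = mdelW d r s' (w ++ y) := by
  induction y using List.reverseRecOn with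
  | nil => simpa using hs
  | append_singleton y x ih =>
    rw [← List.append_assoc] at h ⊢
    have ih := ih h.left
    obtain ⟨p, v, hpv, hvl⟩ : ∃ p v, w ++ y = p ++ v ∧ v.length = t.length :=
      ⟨(w ++ y).take ((w ++ y).length - t.length), (w ++ y).drop ((w ++ y).length - t.length),
        by simp, by simp; omega⟩
    rw [hpv] at h ih ⊢
    have hv : v ∈ mOrbit d r t := h.left.right.mem hvl
    rw [List.append_assoc] at h ⊢
    have hg := h.right
    rw [mdelW_append, mdelW_append] at ih
    obtain ⟨h1, h2⟩ := List.append_inj ih (by simp [mdelW_length])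
    rw [mdelW_append, mdelW_append d r s', h1]
    congr 1
    apply edge_take_inj hd ht hv hg ⟨_, rfl⟩ ⟨_, rfl⟩
    simp only [mdelW_take, ← hvl, List.take_left, h2]

/-- `c` labels a path from the stem `w` to the stem `v`. -/
def JPath (d : A → Q → Q) (r : Q → A → A) (t w c v : List Q) : Prop :=
  w.length = t.length ∧ v.length = t.length ∧ JGood d r t (c ++ v) ∧ w <+: c ++ v


theorem JPath.comp {w c v c' v' : List Q} (h1 : JPath d r t w c v) (h2 : JPath d r t v c' v') :
    JPath d r t w (c ++ c') v' := by
  obtain ⟨hw, hv, hg, hp⟩ := h1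
  obtain ⟨_, hv', hg', y, hy⟩ := h2
  refine ⟨hw, hv', ?_, ?_⟩
  · rw [List.append_assoc, ← hy, ← List.append_assoc]
    exact hg.glue (hy ▸ hg') hv.ge
  · rw [List.append_assoc, ← hy, ← List.append_assoc]
    exact hp.trans (List.prefix_append _ _)

theorem JPath.nil {w : List Q} (hw : w ∈ mOrbit d r t) : JPath d r t w [] w :=
  ⟨mOrbit_length hw, mOrbit_length hw, JGood.of_mem hw, List.prefix_refl _⟩

theorem JPath.mem_left {w c v : List Q} (h : JPath d r t w c v) : w ∈ mOrbit d r t := by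
  obtain ⟨y, hy⟩ := h.2.2.2
  have := h.2.2.1
  rw [← hy] at this
  exact this.left.mem h.1

theorem JPath.mem_right {w c v : List Q} (h : JPath d r t w c v) : v ∈ mOrbit d r t :=
  h.2.2.1.right.mem h.2.1

theorem JPath.pow {w c : List Q} (h : JPath d r t w c w) (k : ℕ) :
    JPath d r t w (List.replicate k c).flatten w := by
  induction k with
  | zero => simpa using JPath.nil h.mem_left
  | succ k ih => simpa [List.replicate_succ] using h.comp ih

theorem edge_return (hr : MInvertible r) (hd : MReversible d) (ht : IsJungleTrunk d r t)
    {v w : List Q} {x q : Q} (hv : v ∈ mOrbit d r t) (h : JGood d r t (v ++ [x]))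
    (hq : v ++ [x] = q :: w) : ∃ c, JPath d r t w c v := by
  have hvl := mOrbit_length hv
  have hlen := congrArg List.length hq
  simp at hlen
  have hwm : w ∈ mOrbit d r t := by
    have h' := h
    rw [hq, ← List.singleton_append] at h'
    exact h'.right.mem (by omega)
  have hi1 := edge_take_inj hd ht hv h
  have hi2 := edge_tail_inj hr hd ht hv h hq hwm
  set O := mOrbit d r (v ++ [x]) with hO
  set R : Set (List Q) := {y | ∃ c, JPath d r t w c y} with hR
  have hRf : R.Finite := (mOrbit_finite d r t).subset fun y ⟨c, hc⟩ => hc.mem_right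
  set OR : Set (List Q) := {o | o ∈ O ∧ o.take t.length ∈ R} with hOR
  have hORO : OR ⊆ O := fun o ho => ho.1
  have hmem : ∀ o ∈ O, JGood d r t o ∧ o.length = t.length + 1 := by
    rintro o ⟨s, rfl⟩
    exact ⟨h.act s, by simp [mdelW_length, hvl]⟩
  have htl : List.tail '' OR ⊆ R := by
    rintro _ ⟨o, ⟨ho, c, hc⟩, rfl⟩
    obtain ⟨hg, hl⟩ := hmem o ho
    cases o with
    | nil => simp at hl
    | cons a o =>
      refine ⟨_, hc.comp (c' := [a]) ⟨by simp [hl], ?_, hg, List.take_prefix _ _⟩⟩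
      simpa using hl
  have htk : List.take t.length '' OR = R := by
    ext y
    constructor
    · rintro ⟨o, ho, rfl⟩
      exact ho.2
    · intro hy
      obtain ⟨c, hc⟩ := id hy
      have hym := hc.mem_right
      rw [← mOrbit_eq hd hv] at hym
      obtain ⟨s, hs⟩ := hym
      have he : (mdelW d r s (v ++ [x])).take t.length = y := by
        rw [mdelW_take, ← hvl, List.take_left, hs]
      exact ⟨mdelW d r s (v ++ [x]), ⟨⟨s, rfl⟩, by rw [he]; exact hy⟩, he⟩
  have hc1 : R.ncard = OR.ncard := by
    rw [← htk, Set.ncard_image_of_injOn (hi1.mono hORO)]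
  have heq := Set.eq_of_subset_of_ncard_le htl
    (by rw [Set.ncard_image_of_injOn (hi2.mono hORO), hc1]) hRf
  have hwR : w ∈ R := ⟨[], JPath.nil hwm⟩
  rw [← heq] at hwR
  obtain ⟨o, ho, how⟩ := hwR
  have : o = v ++ [x] := hi2 ho.1 (mOrbit_self d r _) (by rw [how, hq]; rfl)
  have hh := ho.2
  rw [this, ← hvl, List.take_left] at hh
  exact hh

theorem JPath.ret (hr : MInvertible r) (hd : MReversible d) (ht : IsJungleTrunk d r t)
    {w c v : List Q} (h : JPath d r t w c v) : ∃ c', JPath d r t v c' w := by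
  induction c generalizing w with
  | nil =>
    have : w = v := h.2.2.2.eq_of_length (by simp [h.1, h.2.1])
    subst this
    exact ⟨[], h⟩
  | cons q c ih =>
    obtain ⟨hw, hv, hg, hp⟩ := h
    have hg1 : JGood d r t ([q] ++ (c ++ v)) := hg
    have h2 : JPath d r t ((c ++ v).take t.length) c v :=
      ⟨by simp; omega, hv, hg1.right, List.take_prefix _ _⟩
    obtain ⟨c1, hc1⟩ := ih h2
    have hwe : w = (q :: (c ++ v)).take t.length := by
      rw [← hw]; exact List.prefix_iff_eq_take.1 hp
    have hwm : w ∈ mOrbit d r t := by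
      have := hg 0 (by simp; omega)
      rw [hwe]; simpa using this
    obtain ⟨x, hx⟩ : ∃ x, w ++ [x] = q :: (c ++ v).take t.length := by
      have hn : t.length < (q :: (c ++ v)).length := by simp; omega
      refine ⟨(q :: (c ++ v))[t.length], ?_⟩
      rw [hwe, List.take_append_getElem hn, List.take_succ_cons]
    have hgx : JGood d r t (w ++ [x]) := by
      rw [hx, ← List.take_succ_cons]
      have : JGood d r t ((q :: (c ++ v)).take (t.length + 1) ++
        (q :: (c ++ v)).drop (t.length + 1)) := by
        rw [List.take_append_drop]; exact hg
      exact this.left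
    obtain ⟨c2, hc2⟩ := edge_return hr hd ht hwm hgx hx
    exact ⟨_, hc1.comp hc2⟩

theorem ext_right (hd : MReversible d) (ht : IsJungleTrunk d r t) (m : ℕ) {v : List Q}
    (hv : t.length ≤ v.length) (hg : JGood d r t v) :
    ∃ b : List Q, b.length = m ∧ JGood d r t (v ++ b) := by
  induction m with
  | zero => exact ⟨[], rfl, by simpa using hg⟩
  | succ m ih =>
    obtain ⟨b, hb, hgb⟩ := ih
    obtain ⟨p, w, hpw, hwl⟩ : ∃ p w, v ++ b = p ++ w ∧ w.length = t.length :=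
      ⟨(v ++ b).take ((v ++ b).length - t.length), (v ++ b).drop ((v ++ b).length - t.length),
        by simp, by simp; omega⟩
    rw [hpw] at hgb
    obtain ⟨x, _, _, hx, _⟩ := stem_ext hd ht (hgb.right.mem hwl)
    refine ⟨b ++ [x], by simp [hb], ?_⟩
    rw [← List.append_assoc, hpw]
    exact hgb.glue hx hwl.ge

theorem ext_left_one (hr : MInvertible r) (hd : MReversible d) (ht : IsJungleTrunk d r t)
    {v : List Q} (hv : v ∈ mOrbit d r t) : ∃ q, JGood d r t ([q] ++ v) := by
  obtain ⟨x, _, _, hx, _⟩ := stem_ext hd ht hv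
  obtain ⟨q, w, hq⟩ : ∃ q w, v ++ [x] = q :: w := by
    cases v with
    | nil => exact ⟨x, [], rfl⟩
    | cons a v => exact ⟨a, v ++ [x], rfl⟩
  obtain ⟨c, hc⟩ := edge_return hr hd ht hv hx hq
  have hl := congrArg List.length hq
  simp at hl
  have hp : JPath d r t v [q] w :=
    ⟨mOrbit_length hv, by rw [← mOrbit_length hv]; omega, by
      rw [List.singleton_append, ← hq]; exact hx, by
      rw [List.singleton_append, ← hq]; exact List.prefix_append _ _⟩
  have hg := (hp.comp hc).2.2.1
  obtain ⟨c', a, hca⟩ : ∃ c' a, [q] ++ c = c' ++ [a] :=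
    ⟨([q] ++ c).dropLast, ([q] ++ c).getLast (by simp), by rw [List.dropLast_append_getLast]⟩
  rw [hca, List.append_assoc] at hg
  exact ⟨a, hg.right⟩

theorem ext_left (hr : MInvertible r) (hd : MReversible d) (ht : IsJungleTrunk d r t) (m : ℕ)
    {v : List Q} (hv : v ∈ mOrbit d r t) :
    ∃ p : List Q, p.length = m ∧ JGood d r t (p ++ v) := by
  induction m with
  | zero => exact ⟨[], rfl, by simpa using JGood.of_mem hv⟩
  | succ m ih =>
    obtain ⟨p, hp, hg⟩ := ih
    have hvl := mOrbit_length hv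
    have hsplit := List.take_append_drop t.length (p ++ v)
    rw [← hsplit] at hg
    have hl : ((p ++ v).take t.length).length = t.length := by simp; omega
    obtain ⟨q, hq⟩ := ext_left_one hr hd ht (hg.left.mem hl)
    refine ⟨q :: p, by simp [hp], ?_⟩
    have := hq.glue hg hl.ge
    rw [List.append_assoc, hsplit] at this
    exact this

theorem JPath.order [Finite A] (hr : MInvertible r) (hd : MReversible d)
    (ht : IsJungleTrunk d r t) {w c : List Q} (h : JPath d r t w c w) :
    ∃ k : ℕ, ∀ s : List A, mrhoW d r (List.replicate (k + 1) c).flatten s = s := by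
  set C : ℕ → List Q := fun m => (List.replicate m c).flatten with hC
  have hwd : ∀ m s s', mdelW d r s w = mdelW d r s' w → mdelW d r s (C m) = mdelW d r s' (C m) := by
    intro m s s' hs
    obtain ⟨_, _, hg, y, hy⟩ := h.pow m
    have := unique_ext hd ht h.1 y (hy ▸ hg) s s' hs
    rw [hy, mdelW_append, mdelW_append] at this
    exact (List.append_inj this (by simp [mdelW_length])).1
  haveI : Finite (mOrbit d r w) := mOrbit_finite d r w
  choose σ hσ using fun x : mOrbit d r w => x.2
  let f : ℕ → (mOrbit d r w) → A → A := fun m x i =>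
    (mdelW d r (σ x) (C m)).foldl (fun i x => r x i) i
  obtain ⟨a, b, hab, hf⟩ := Finite.exists_ne_map_eq_of_infinite f
  wlog hlt : a < b generalizing a b
  · exact this b a hab.symm hf.symm (by omega)
  have key : ∀ (s' s : List A),
      mrhoW d r (mdelW d r s (C a)) s' = mrhoW d r (mdelW d r s (C b)) s' := by
    intro s'
    induction s' with
    | nil => intro s; rw [mrhoW_nil, mrhoW_nil]
    | cons i s' ih =>
      intro s
      have e := congrFun (congrFun hf ⟨mdelW d r s w, s, rfl⟩) i
      simp only [f] at e
      rw [hwd a _ s (hσ _), hwd b _ s (hσ _)] at e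
      rw [mrhoW_cons, mrhoW_cons, e, ← mdelW_word_append, ← mdelW_word_append, ih]
  refine ⟨b - a - 1, fun s => ?_⟩
  obtain ⟨s', rfl⟩ := mrhoW_surj d r hr (C a) s
  rw [← mrhoW_append]
  have e : C a ++ (List.replicate (b - a - 1 + 1) c).flatten = C b := by
    simp only [hC]
    rw [← List.flatten_append, List.replicate_append_replicate]
    congr 2; omega
  rw [e]
  exact (key s' []).symm

end Helpers

/-- For every `∼`-class (represented by a stem `g`) and every `j`-word `u` of length
`< n` which is a prefix of some stem of the class, the number of states `q` such that
`u·q` is a prefix of some stem of the class is at least `2`. -/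
theorem statement17 [Fintype Q] [Fintype A] [Nonempty Q] [Nonempty A]
    (d : A → Q → Q) (r : Q → A → A)
    (hbi : MBireversible d r) (hconn : MConnected d r)
    (hnab : ¬ HasActiveSelfLiftableBranch d r)
    (t : List Q) (ht : IsJungleTrunk d r t)
    (g u : List Q) (hg : IsStem d r t g)
    (hu : IsJWord d r t u) (hlt : u.length < t.length)
    (hpref : ∃ z : List Q, IsStem d r t z ∧ StemEquiv d r t g z ∧ u <+: z) :
    2 ≤ {q : Q | ∃ z : List Q, IsStem d r t z ∧ StemEquiv d r t g z ∧
          (u ++ [q]) <+: z}.ncard := by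
  obtain ⟨z, hz, ⟨s, hgz, hid⟩, hpz⟩ := hpref
  obtain ⟨hr, hd, -⟩ := hbi
  have hz0 := hz
  have hgl := hg.2
  rw [isStem_iff] at hz
  have hzl := mOrbit_length hz
  obtain ⟨a, rfl⟩ := hpz
  have hal : a.length = t.length - u.length := by simp at hzl; omega
  obtain ⟨w', hw'l, hw'⟩ := ext_left hr hd ht (t.length - u.length) hz
  have hwl : (w' ++ u).length = t.length := by simp; omega
  have hwa : JGood d r t ((w' ++ u) ++ a) := by rw [List.append_assoc]; exact hw'
  have hwm : w' ++ u ∈ mOrbit d r t := hwa.left.mem hwl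
  obtain ⟨x, a', rfl⟩ : ∃ x a', a = x :: a' := by
    cases a with
    | nil => simp at hal; omega
    | cons x a' => exact ⟨x, a', rfl⟩
  obtain ⟨y, hyx, hy⟩ : ∃ y, y ≠ x ∧ JGood d r t ((w' ++ u) ++ [y]) := by
    obtain ⟨y1, y2, hne, h1, h2⟩ := stem_ext hd ht hwm
    by_cases h : y1 = x
    · exact ⟨y2, fun h' => hne (h.trans h'.symm), h2⟩
    · exact ⟨y1, h, h1⟩
  obtain ⟨b, hb, hgb⟩ := ext_right hd ht (t.length - u.length - 1)
    (by simp only [List.length_append] at hwl ⊢; omega) hy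
  have hgb' : JGood d r t (w' ++ (u ++ y :: b)) := by simpa using hgb
  have hzbl : (u ++ y :: b).length = t.length := by simp; omega
  have hp1 : JPath d r t (w' ++ u) w' (u ++ x :: a') :=
    ⟨hwl, hzl, hw', by rw [← List.append_assoc]; exact List.prefix_append _ _⟩
  have hp2 : JPath d r t (w' ++ u) w' (u ++ y :: b) :=
    ⟨hwl, hzbl, hgb', by rw [← List.append_assoc]; exact List.prefix_append _ _⟩
  obtain ⟨c', hc'⟩ := hp1.ret hr hd ht
  have hloop := hp1.comp hc'
  obtain ⟨k, hk⟩ := hloop.order hr hd ht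
  set c := c' ++ (List.replicate k (w' ++ c')).flatten with hc
  have hcp : JPath d r t (u ++ x :: a') c (w' ++ u) := hc'.comp (hloop.pow k)
  have hk' : ∀ s, mrhoW d r c (mrhoW d r w' s) = s := by
    intro s
    have := hk s
    rw [List.replicate_succ, List.flatten_cons, List.append_assoc, mrhoW_append] at this
    exact this
  have hcyc : ∀ s, mrhoW d r (c ++ w') s = s := by
    intro s
    obtain ⟨s', rfl⟩ := mrhoW_surj d r hr w' s
    rw [mrhoW_append, hk']
  obtain ⟨-, -, hgf, e, he⟩ := hcp.comp hp2
  have hgz' := (isJWord_iff d r t _ (by simp; omega)).1 hgz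
  have hfin : JGood d r t (g ++ (s ++ (c ++ w')) ++ (u ++ y :: b)) := by
    have := hgz'.glue (he ▸ hgf) hzl.ge
    rw [List.append_assoc, he] at this
    simpa using this
  have hmem : ({x, y} : Set Q) ⊆ {q : Q | ∃ z : List Q, IsStem d r t z ∧ StemEquiv d r t g z ∧
          (u ++ [q]) <+: z} := by
    rintro q (rfl | rfl)
    · exact ⟨_, hz0, ⟨s, hgz, hid⟩, a', by simp⟩
    · refine ⟨_, (isStem_iff _ _ _ _).2 (hgb'.right.mem hzbl),
        ⟨s ++ (c ++ w'), (isJWord_iff d r t _ (by simp; omega)).2 hfin, ?_⟩, b, by simp⟩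
      intro X
      rw [← List.append_assoc, mrhoW_append, hid, hcyc]
  calc 2 = ({x, y} : Set Q).ncard := (Set.ncard_pair hyx.symm).symm
    _ ≤ _ := Set.ncard_le_ncard hmem (Set.toFinite _)
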